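/- Let H be a real Hilbert space, let ρ, μ, δ, ε > 0 and 0 ≤ β < 1, let t ≥ 0, let w ∈ H, and let v : [0, t] → H be strongly measurable with s ↦ (t−s)^{−β} e^{−δ(t−s)} v(s) Bochner integrable on [0, t] and ∫₀^t (t−s)^{−β} e^{−δ(t−s)} ‖v(s)‖² ds < ∞. Then |⟨ρ ∫₀^t (t−s)^{−β} e^{−δ(t−s)} v(s) ds, w⟩| ≤ (μ/ε) ‖w‖² + (ε ρ²/(4μ)) · (Γ(1−β)/δ^{1−β}) · ∫₀^t (t−s)^{−β} e^{−δ(t−s)} ‖v(s)‖² ds. -/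

import Mathlib

open MeasureTheory Real

lemma integrableOn_rpow_neg_mul_exp_neg {β δ : ℝ} (hδ : 0 < δ) (hβ : β < 1) :
    IntegrableOn (fun x : ℝ => x ^ (-β) * Real.exp (-δ * x)) (Set.Ioi 0) := by
  simpa using integrableOn_rpow_mul_exp_neg_mul_rpow (p := 1) (s := -β) (b := δ)
    (by linarith) one_pos hδ

lemma integral_rpow_neg_mul_exp_neg {β δ : ℝ} (hδ : 0 < δ) (hβ : β < 1) :
    ∫ x in Set.Ioi (0 : ℝ), x ^ (-β) * Real.exp (-δ * x) =
      Real.Gamma (1 - β) / δ ^ (1 - β) := by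
  have h := Real.integral_rpow_mul_exp_neg_mul_Ioi (a := 1 - β) (by linarith) hδ
  rw [Real.div_rpow zero_le_one hδ.le, Real.one_rpow, one_div_mul_eq_div] at h
  rw [← h]
  congr 1 with x
  ring_nf

lemma indicator_Ioi_sub_left_eq {f : ℝ → ℝ} {t : ℝ} :
    Set.EqOn (fun s => (Set.Ioi 0).indicator f (t - s)) (fun s => f (t - s)) (Set.Ioo 0 t) :=
  fun _ hs => Set.indicator_of_mem (Set.mem_Ioi.2 (sub_pos.2 hs.2)) f

lemma integrableOn_memoryKernel {β δ t : ℝ} (hδ : 0 < δ) (hβ : β < 1) :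
    IntegrableOn (fun s : ℝ => (t - s) ^ (-β) * Real.exp (-δ * (t - s))) (Set.Ioc 0 t) := by
  have h := ((integrableOn_rpow_neg_mul_exp_neg hδ hβ).integrable_indicator
    measurableSet_Ioi).comp_sub_left t
  rw [integrableOn_Ioc_iff_integrableOn_Ioo]
  exact h.integrableOn.congr_fun indicator_Ioi_sub_left_eq measurableSet_Ioo

lemma setIntegral_memoryKernel_le {β δ t : ℝ} (hδ : 0 < δ) (hβ : β < 1) :
    ∫ s in Set.Ioc (0 : ℝ) t, (t - s) ^ (-β) * Real.exp (-δ * (t - s)) ≤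
      Real.Gamma (1 - β) / δ ^ (1 - β) := by
  set f : ℝ → ℝ := fun x => x ^ (-β) * Real.exp (-δ * x) with hf
  have h := ((integrableOn_rpow_neg_mul_exp_neg hδ hβ).integrable_indicator
    measurableSet_Ioi).comp_sub_left t
  calc ∫ s in Set.Ioc (0 : ℝ) t, f (t - s)
      = ∫ s in Set.Ioo (0 : ℝ) t, (Set.Ioi 0).indicator f (t - s) := by
        rw [integral_Ioc_eq_integral_Ioo]
        exact (setIntegral_congr_fun measurableSet_Ioo indicator_Ioi_sub_left_eq).symm
    _ ≤ ∫ s, (Set.Ioi 0).indicator f (t - s) := by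
        refine setIntegral_le_integral h (Filter.Eventually.of_forall fun s => ?_)
        exact Set.indicator_nonneg (fun x hx => mul_nonneg
          (Real.rpow_nonneg (le_of_lt hx) _) (Real.exp_pos _).le) _
    _ = ∫ x in Set.Ioi (0 : ℝ), f x := by
        rw [integral_sub_left_eq_self (fun x => (Set.Ioi 0).indicator f x),
          integral_indicator measurableSet_Ioi]
    _ = _ := integral_rpow_neg_mul_exp_neg hδ hβ

/-- Hilbert-space core of the memory-functional estimate (Lemma on `J(t; v, Aʳw)`):
`|⟨ρ ∫₀ᵗ (t-s)^{-β} e^{-δ(t-s)} v(s) ds, w⟩|`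
  `≤ (μ/ε)‖w‖² + (ερ²/(4μ)) (Γ(1-β)/δ^{1-β}) ∫₀ᵗ (t-s)^{-β} e^{-δ(t-s)} ‖v(s)‖² ds`. -/
theorem memory_functional_estimate
    {H : Type*} [NormedAddCommGroup H] [InnerProductSpace ℝ H]
    (ρ μ δ ε β t : ℝ) (hρ : 0 < ρ) (hμ : 0 < μ) (hδ : 0 < δ) (hε : 0 < ε)
    (hβ0 : 0 ≤ β) (hβ1 : β < 1) (ht : 0 ≤ t)
    (w : H) (v : ℝ → H)
    (hv_meas : AEStronglyMeasurable v (volume.restrict (Set.Ioc 0 t)))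
    (hv_int : IntegrableOn
      (fun s => ((t - s) ^ (-β) * Real.exp (-δ * (t - s))) • v s) (Set.Ioc 0 t))
    (hv_sq_int : IntegrableOn
      (fun s => (t - s) ^ (-β) * Real.exp (-δ * (t - s)) * ‖v s‖ ^ 2)
      (Set.Ioc 0 t)) :
    |@inner ℝ H _
        (ρ • ∫ s in Set.Ioc (0:ℝ) t,
          ((t - s) ^ (-β) * Real.exp (-δ * (t - s))) • v s) w|
      ≤ (μ / ε) * ‖w‖ ^ 2 +
        (ε * ρ ^ 2 / (4 * μ)) * (Real.Gamma (1 - β) / δ ^ (1 - β)) *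
          ∫ s in Set.Ioc (0:ℝ) t,
            (t - s) ^ (-β) * Real.exp (-δ * (t - s)) * ‖v s‖ ^ 2 := by
  set k : ℝ → ℝ := fun s => (t - s) ^ (-β) * Real.exp (-δ * (t - s)) with hk
  set G : ℝ := Real.Gamma (1 - β) / δ ^ (1 - β) with hG
  have hGpos : 0 < G := div_pos (Real.Gamma_pos_of_pos (by linarith)) (by positivity)
  have hk_int : IntegrableOn k (Set.Ioc 0 t) := integrableOn_memoryKernel hδ hβ1
  have hk_le : ∫ s in Set.Ioc (0:ℝ) t, k s ≤ G := setIntegral_memoryKernel_le hδ hβ1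
  have hk_nonneg : ∀ s ∈ Set.Ioc 0 t, 0 ≤ k s := fun s hs =>
    mul_nonneg (Real.rpow_nonneg (sub_nonneg.2 hs.2) _) (Real.exp_pos _).le
  have hpt : ∀ x : ℝ, ρ * ‖w‖ * x ≤
      μ / ε / G * ‖w‖ ^ 2 + ε * ρ ^ 2 / (4 * μ) * G * x ^ 2 := by
    intro x
    have h : μ / ε / G * ‖w‖ ^ 2 + ε * ρ ^ 2 / (4 * μ) * G * x ^ 2 - ρ * ‖w‖ * x =
        μ / ε / G * (‖w‖ - ε * G * ρ / (2 * μ) * x) ^ 2 := by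
      field_simp
      ring
    have : 0 ≤ μ / ε / G * (‖w‖ - ε * G * ρ / (2 * μ) * x) ^ 2 := by positivity
    linarith
  calc |@inner ℝ H _ (ρ • ∫ s in Set.Ioc (0:ℝ) t, k s • v s) w|
      ≤ ‖ρ • ∫ s in Set.Ioc (0:ℝ) t, k s • v s‖ * ‖w‖ := abs_real_inner_le_norm _ _
    _ = ρ * ‖w‖ * ‖∫ s in Set.Ioc (0:ℝ) t, k s • v s‖ := by
      rw [norm_smul, Real.norm_of_nonneg hρ.le]
      ring
    _ ≤ ρ * ‖w‖ * ∫ s in Set.Ioc (0:ℝ) t, ‖k s • v s‖ := by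
      gcongr
      exact norm_integral_le_integral_norm _
    _ = ∫ s in Set.Ioc (0:ℝ) t, ρ * ‖w‖ * ‖k s • v s‖ := (integral_const_mul _ _).symm
    _ ≤ ∫ s in Set.Ioc (0:ℝ) t,
        (μ / ε / G * ‖w‖ ^ 2 * k s + ε * ρ ^ 2 / (4 * μ) * G * (k s * ‖v s‖ ^ 2)) := by
      refine setIntegral_mono_on (hv_int.norm.const_mul _)
        ((hk_int.const_mul _).add (hv_sq_int.const_mul _)) measurableSet_Ioc fun s hs => ?_
      rw [norm_smul, Real.norm_of_nonneg (hk_nonneg s hs)]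
      have := mul_le_mul_of_nonneg_left (hpt ‖v s‖) (hk_nonneg s hs)
      linarith
    _ = μ / ε / G * ‖w‖ ^ 2 * (∫ s in Set.Ioc (0:ℝ) t, k s) +
        ε * ρ ^ 2 / (4 * μ) * G * ∫ s in Set.Ioc (0:ℝ) t, k s * ‖v s‖ ^ 2 := by
      rw [integral_add (hk_int.const_mul _) (hv_sq_int.const_mul _), integral_const_mul,
        integral_const_mul]
    _ ≤ μ / ε / G * ‖w‖ ^ 2 * G +
        ε * ρ ^ 2 / (4 * μ) * G * ∫ s in Set.Ioc (0:ℝ) t, k s * ‖v s‖ ^ 2 := by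
      gcongr
    _ = _ := by
      congr 1
      field_simp
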